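/- Let w be a weight on ℝⁿ with [w]_{A∞} < ∞ and let f ∈ BMO. Then there exists a dimensional constant C_n, independent of f and w, such that for every cube Q, the exponential Luxemburg norm of f − f_Q with respect to the probability measure w dx / w(Q) on Q satisfies ‖f − f_Q‖_{exp L(Q, w dx/w(Q))} ≤ C_n [w]_{A∞} ‖f‖_{BMO}. -/

import Mathlib

open MeasureTheory ENNReal Set

noncomputable section

/-- The axis-parallel cube in `ℝⁿ` with lower corner `a` and side length `h`. -/
def Cube {n : ℕ} (a : Fin n → ℝ) (h : ℝ) : Set (Fin n → ℝ) :=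
  Set.univ.pi fun i => Set.Icc (a i) (a i + h)

/-- The concentric double `2Q` of the cube with lower corner `a` and side length `h`. -/
def Cube2 {n : ℕ} (a : Fin n → ℝ) (h : ℝ) : Set (Fin n → ℝ) :=
  Cube (fun i => a i - h / 2) (2 * h)

/-- The average `f_Q` of `f` over the cube with lower corner `a` and side length `h`. -/
def cubeAvg {n : ℕ} (a : Fin n → ℝ) (h : ℝ) (f : (Fin n → ℝ) → ℝ) : ℝ :=
  ⨍ x in Cube a h, f x

/-- The (uncentered) Hardy–Littlewood maximal function over axis-parallel cubes. -/
def maxFn {n : ℕ} (f : (Fin n → ℝ) → ℝ) (x : Fin n → ℝ) : ℝ≥0∞ :=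
  ⨆ (a : Fin n → ℝ) (h : ℝ) (_ : 0 < h) (_ : x ∈ Cube a h),
    (∫⁻ y in Cube a h, ENNReal.ofReal |f y|) / volume (Cube a h)

/-- The BMO seminorm `sup_Q (1/|Q|) ∫_Q |f - f_Q|`, valued in `ℝ≥0∞`. -/
def bmoNorm {n : ℕ} (f : (Fin n → ℝ) → ℝ) : ℝ≥0∞ :=
  ⨆ (a : Fin n → ℝ) (h : ℝ) (_ : 0 < h),
    (∫⁻ x in Cube a h, ENNReal.ofReal |f x - cubeAvg a h f|) / volume (Cube a h)

/-- The generalized weighted BMO norm `‖f‖_{BMO_{v,Y}} = sup_Q (1/Y(Q)) ∫_Q |f - f_Q| v`. -/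
def bmoVY {n : ℕ} (v : (Fin n → ℝ) → ℝ) (Y : (Fin n → ℝ) → ℝ → ℝ≥0∞)
    (f : (Fin n → ℝ) → ℝ) : ℝ≥0∞ :=
  ⨆ (a : Fin n → ℝ) (h : ℝ) (_ : 0 < h),
    (∫⁻ x in Cube a h, ENNReal.ofReal (|f x - cubeAvg a h f| * v x)) / Y a h

/-- `w(Q) = ∫_Q w` for a cube `Q`. -/
def wInt {n : ℕ} (w : (Fin n → ℝ) → ℝ) (a : Fin n → ℝ) (h : ℝ) : ℝ≥0∞ :=
  ∫⁻ x in Cube a h, ENNReal.ofReal (w x)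

/-- `w(2Q) = ∫_{2Q} w` for a cube `Q`. -/
def wInt2 {n : ℕ} (w : (Fin n → ℝ) → ℝ) (a : Fin n → ℝ) (h : ℝ) : ℝ≥0∞ :=
  ∫⁻ x in Cube2 a h, ENNReal.ofReal (w x)

/-- The generalized Fujii–Wilson constant `[v]_{A_{∞,Y}} = sup_Q (1/Y(Q)) ∫_Q M(v χ_Q)`. -/
def fwY {n : ℕ} (v : (Fin n → ℝ) → ℝ) (Y : (Fin n → ℝ) → ℝ → ℝ≥0∞) : ℝ≥0∞ :=
  ⨆ (a : Fin n → ℝ) (h : ℝ) (_ : 0 < h),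
    (∫⁻ x in Cube a h, maxFn ((Cube a h).indicator v) x) / Y a h

/-- The Fujii–Wilson `A∞` constant `[w]_{A∞} = sup_Q (1/w(Q)) ∫_Q M(w χ_Q)`. -/
def fwConst {n : ℕ} (w : (Fin n → ℝ) → ℝ) : ℝ≥0∞ :=
  ⨆ (a : Fin n → ℝ) (h : ℝ) (_ : 0 < h),
    (∫⁻ x in Cube a h, maxFn ((Cube a h).indicator w) x) / wInt w a h

/-- The weak Fujii–Wilson constant `[w]^{weak}_{A∞} = sup_Q (1/w(2Q)) ∫_Q M(w χ_Q)`. -/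
def fwWeak {n : ℕ} (w : (Fin n → ℝ) → ℝ) : ℝ≥0∞ :=
  ⨆ (a : Fin n → ℝ) (h : ℝ) (_ : 0 < h),
    (∫⁻ x in Cube a h, maxFn ((Cube a h).indicator w) x) / wInt2 w a h

/-- The `C_p` normalizing functional `Y(Q) = ∫_{ℝⁿ} M(χ_Q)^p w`. -/
def cpY {n : ℕ} (p : ℝ) (w : (Fin n → ℝ) → ℝ) (a : Fin n → ℝ) (h : ℝ) : ℝ≥0∞ :=
  ∫⁻ x, (maxFn ((Cube a h).indicator fun _ => (1 : ℝ)) x) ^ p * ENNReal.ofReal (w x)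

/-- The `C_p` Fujii–Wilson-type constant `[w]_{C_p}`. -/
def cpConst {n : ℕ} (p : ℝ) (w : (Fin n → ℝ) → ℝ) : ℝ≥0∞ :=
  ⨆ (a : Fin n → ℝ) (h : ℝ) (_ : 0 < h),
    (∫⁻ x in Cube a h, maxFn ((Cube a h).indicator w) x) / cpY p w a h

/-- The `A_p` constant `[w]_{A_p}` for `1 < p < ∞`. -/
def apConst {n : ℕ} (p : ℝ) (w : (Fin n → ℝ) → ℝ) : ℝ≥0∞ :=
  ⨆ (a : Fin n → ℝ) (h : ℝ) (_ : 0 < h),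
    (wInt w a h / volume (Cube a h)) *
      ((∫⁻ x in Cube a h, ENNReal.ofReal (w x) ^ (1 - p / (p - 1))) / volume (Cube a h)) ^ (p - 1)

/-- A weight: a nonnegative locally integrable function on `ℝⁿ`. -/
def IsWeight {n : ℕ} (v : (Fin n → ℝ) → ℝ) : Prop :=
  (∀ x, 0 ≤ v x) ∧ LocallyIntegrable v volume

/-- A cube functional `Y : 𝒬 → (0,∞)`: positive finite values on cubes. -/
def IsCubeFunctional {n : ℕ} (Y : (Fin n → ℝ) → ℝ → ℝ≥0∞) : Prop :=
  ∀ (a : Fin n → ℝ) (h : ℝ), 0 < h → 0 < Y a h ∧ Y a h < ⊤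

/-- Membership in the class `𝒴_q` with constant `β`: for every cube `Q`, every `L ≥ 1`
and every `L`-small family of pairwise non-overlapping subcubes of `Q`,
`∑_{P ∈ Λ} Y(P) ≤ β Y(Q) L^{-1/q}`. -/
def MemY {n : ℕ} (q β : ℝ) (Y : (Fin n → ℝ) → ℝ → ℝ≥0∞) : Prop :=
  ∀ (a : Fin n → ℝ) (h : ℝ), 0 < h → ∀ L : ℝ, 1 ≤ L →
    ∀ Λ : Set ((Fin n → ℝ) × ℝ),
      (∀ p ∈ Λ, 0 < p.2 ∧ Cube p.1 p.2 ⊆ Cube a h) →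
      (Λ.Pairwise fun p r => Disjoint (interior (Cube p.1 p.2)) (interior (Cube r.1 r.2))) →
      (∑' p : Λ, volume (Cube p.1.1 p.1.2)) ≤ volume (Cube a h) / ENNReal.ofReal L →
      (∑' p : Λ, Y p.1.1 p.1.2) ≤ ENNReal.ofReal β * Y a h * ENNReal.ofReal (L ^ (-1 / q))

/-- The Luxemburg norm in the Orlicz space `exp L^β` with respect to the measure `μ`. -/
def expLuxNorm {X : Type*} [MeasurableSpace X] (μ : Measure X) (β : ℝ) (g : X → ℝ) : ℝ≥0∞ :=
  ⨅ (lam : ℝ) (_ : 0 < lam)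
    (_ : ∫⁻ x, ENNReal.ofReal (Real.exp ((|g x| / lam) ^ β) - 1) ∂μ ≤ 1), ENNReal.ofReal lam

/-- The weighted measure `w dx` restricted to a set `Q`. -/
def wMeasureOn {n : ℕ} (w : (Fin n → ℝ) → ℝ) (Q : Set (Fin n → ℝ)) : Measure (Fin n → ℝ) :=
  (volume.restrict Q).withDensity fun x => ENNReal.ofReal (w x)

/-- The dyadic grid `𝒟(Q)` relative to the cube with lower corner `a₀` and side `h₀`:
parameters of all dyadic subcubes of `Q`. -/
def dyadicOf {n : ℕ} (a₀ : Fin n → ℝ) (h₀ : ℝ) : Set ((Fin n → ℝ) × ℝ) :=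
  {p | ∃ (k : ℕ) (m : Fin n → ℕ), (∀ i, m i < 2 ^ k) ∧
    p.2 = h₀ / 2 ^ k ∧ p.1 = fun i => a₀ i + (m i : ℝ) * (h₀ / 2 ^ k)}

/-- The functional `w_r(Q) = |Q| ((1/|Q|) ∫_Q w^r)^{1/r}`. -/
def wrY {n : ℕ} (w : (Fin n → ℝ) → ℝ) (r : ℝ) (a : Fin n → ℝ) (h : ℝ) : ℝ≥0∞ :=
  volume (Cube a h) *
    ((∫⁻ x in Cube a h, ENNReal.ofReal (w x) ^ r) / volume (Cube a h)) ^ (1 / r)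

/-- The `k`-th generation region below the index `p`: `K p` at generation zero, and then the
union of the `k`-th generation regions of the children of `p`. -/
def genRegion {ι X : Type*} (K : ι → Set X) (ch : ι → Set ι) : ℕ → ι → Set X
  | 0, p => K p
  | k + 1, p => ⋃ r ∈ ch p, genRegion K ch k r

/-- A tree of measurable sets in which the children of a set are countably many pairwise disjoint
subsets filling at most half of it. -/
structure SparseTree {ι X : Type*} [MeasurableSpace X] (μ : Measure X) (K : ι → Set X)
    (ch : ι → Set ι) : Prop where
  meas : ∀ p, MeasurableSet (K p)
  countable : ∀ p, (ch p).Countable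
  subset : ∀ p, ∀ r ∈ ch p, K r ⊆ K p
  disj : ∀ p, (ch p).PairwiseDisjoint K
  half : ∀ p, μ (⋃ r ∈ ch p, K r) ≤ μ (K p) / 2
  ne_zero : ∀ p, μ (K p) ≠ 0
  ne_top : ∀ p, μ (K p) ≠ ⊤

namespace SparseTree

variable {ι X : Type*} [MeasurableSpace X] {μ : Measure X} {K : ι → Set X} {ch : ι → Set ι}

theorem measurableSet_genRegion (T : SparseTree μ K ch) (k : ℕ) (p : ι) :
    MeasurableSet (genRegion K ch k p) := by
  induction k generalizing p with
  | zero => exact T.meas p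
  | succ k ih => exact MeasurableSet.biUnion (T.countable p) fun r _ => ih r

theorem genRegion_subset (T : SparseTree μ K ch) (k : ℕ) (p : ι) :
    genRegion K ch k p ⊆ K p := by
  induction k generalizing p with
  | zero => exact subset_rfl
  | succ k ih => exact iUnion₂_subset fun r hr => (ih r).trans (T.subset p r hr)

theorem measure_genRegion_succ (T : SparseTree μ K ch) (ν : Measure X) (k : ℕ) (p : ι) :
    ν (genRegion K ch (k + 1) p) = ∑' r : ch p, ν (genRegion K ch k r) :=
  measure_biUnion (T.countable p)
    (fun r hr s hs hrs => (T.disj p hr hs hrs).mono (T.genRegion_subset k r)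
      (T.genRegion_subset k s))
    fun r _ => T.measurableSet_genRegion k r

theorem measure_le_two_mul_lintegral_diff (T : SparseTree μ K ch) (ν : Measure X)
    {M : X → ℝ≥0∞} (p : ι) (hM : ∀ x ∈ K p, ν (K p) / μ (K p) ≤ M x) :
    ν (K p) ≤ 2 * ∫⁻ x in K p \ (⋃ r ∈ ch p, K r), M x ∂μ := by
  have hU : MeasurableSet (⋃ r ∈ ch p, K r) :=
    MeasurableSet.biUnion (T.countable p) fun r _ => T.meas r
  have h1 : μ (K p) / 2 ≤ μ (K p \ (⋃ r ∈ ch p, K r)) := by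
    have h2 : μ (K p) - μ (⋃ r ∈ ch p, K r) ≤ μ (K p \ (⋃ r ∈ ch p, K r)) := le_measure_sdiff
    refine le_trans ?_ h2
    calc μ (K p) / 2 = μ (K p) - μ (K p) / 2 := by
          rw [ENNReal.sub_half (T.ne_top p)]
      _ ≤ _ := tsub_le_tsub_left (T.half p) _
  calc ν (K p) = 2 * (ν (K p) / μ (K p) * (μ (K p) / 2)) := by
        rw [div_eq_mul_inv (μ (K p)) 2, ← mul_assoc (ν (K p) / μ (K p)),
          ENNReal.div_mul_cancel (T.ne_zero p) (T.ne_top p), mul_comm, mul_assoc,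
          ENNReal.inv_mul_cancel two_ne_zero ofNat_ne_top, mul_one]
    _ ≤ 2 * (ν (K p) / μ (K p) * μ (K p \ (⋃ r ∈ ch p, K r))) := by gcongr
    _ = 2 * ∫⁻ _ in K p \ (⋃ r ∈ ch p, K r), ν (K p) / μ (K p) ∂μ := by
        rw [setLIntegral_const]
    _ ≤ _ := by
        gcongr 2 * ?_
        exact setLIntegral_mono' ((T.meas p).diff hU) fun x hx => hM x hx.1

theorem sum_measure_genRegion_le (T : SparseTree μ K ch) (ν : Measure X) {M : X → ℝ≥0∞}
    (N : ℕ) (p : ι) (hM : ∀ r, K r ⊆ K p → ∀ x ∈ K r, ν (K r) / μ (K r) ≤ M x) :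
    ∑ j ∈ Finset.range N, ν (genRegion K ch j p) ≤ 2 * ∫⁻ x in K p, M x ∂μ := by
  induction N generalizing p with
  | zero => simp
  | succ N ih =>
    have hU : MeasurableSet (⋃ r ∈ ch p, K r) :=
      MeasurableSet.biUnion (T.countable p) fun r _ => T.meas r
    have hsub : (⋃ r ∈ ch p, K r) ⊆ K p := iUnion₂_subset (T.subset p)
    have hsum : ∑ j ∈ Finset.range N, ν (genRegion K ch (j + 1) p)
        ≤ 2 * ∫⁻ x in ⋃ r ∈ ch p, K r, M x ∂μ := by
      simp_rw [T.measure_genRegion_succ]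
      rw [lintegral_biUnion (T.countable p) (fun r _ => T.meas r) (T.disj p), ← ENNReal.tsum_mul_left,
        ← Summable.tsum_finsetSum (fun _ _ => ENNReal.summable)]
      exact ENNReal.tsum_le_tsum fun r => ih r fun s hs => hM s (hs.trans (T.subset p r r.2))
    rw [Finset.sum_range_succ', ← lintegral_inter_add_sdiff M (K p) hU, inter_eq_right.2 hsub, mul_add]
    exact add_le_add hsum (T.measure_le_two_mul_lintegral_diff ν p (hM p subset_rfl))

theorem sum_measure_genRegion_add_le (T : SparseTree μ K ch) (ν : Measure X) {Λ : ℝ≥0∞}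
    (N : ℕ) (hΛ : ∀ p, ∑ j ∈ Finset.range N, ν (genRegion K ch j p) ≤ Λ * ν (K p))
    (k : ℕ) (p : ι) :
    ∑ j ∈ Finset.range N, ν (genRegion K ch (k + j) p) ≤ Λ * ν (genRegion K ch k p) := by
  induction k generalizing p with
  | zero => simpa [genRegion] using hΛ p
  | succ k ih =>
    simp_rw [Nat.add_right_comm k 1, T.measure_genRegion_succ]
    rw [← ENNReal.tsum_mul_left, ← Summable.tsum_finsetSum (fun _ _ => ENNReal.summable)]
    exact ENNReal.tsum_le_tsum fun r => ih r

theorem ae_abs_sub_le_of_notMem_genRegion (T : SparseTree μ K ch) {f : X → ℝ} {A : ι → ℝ} {B : ℝ}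
    (hoff : ∀ p, ∀ᵐ x ∂μ, x ∈ K p → x ∉ (⋃ r ∈ ch p, K r) → |f x - A p| ≤ B)
    (hstep : ∀ p, ∀ r ∈ ch p, |A r - A p| ≤ B) (k : ℕ) (p : ι) :
    ∀ᵐ x ∂μ, x ∈ K p → x ∉ genRegion K ch k p → |f x - A p| ≤ k * B := by
  induction k generalizing p with
  | zero => exact Filter.Eventually.of_forall fun x hx hx' => absurd hx hx'
  | succ k ih =>
    have hB : ∀ᵐ x ∂μ, ∀ r ∈ ch p, x ∈ K r → x ∉ genRegion K ch k r → |f x - A r| ≤ k * B :=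
      (ae_ball_iff (T.countable p)).2 fun r _ => ih r
    filter_upwards [hoff p, hB] with x h1 h2 hx hxk
    push_cast
    by_cases hxU : x ∈ ⋃ r ∈ ch p, K r
    · obtain ⟨r, hr, hxr⟩ := mem_iUnion₂.1 hxU
      have h3 := h2 r hr hxr fun h => hxk (mem_iUnion₂.2 ⟨r, hr, h⟩)
      have h4 := abs_sub_le (f x) (A r) (A p)
      linarith [hstep p r hr]
    · have h3 := h1 hx hxU
      have : 0 ≤ (k : ℝ) * B := mul_nonneg k.cast_nonneg ((abs_nonneg _).trans h3)
      linarith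

end SparseTree

theorem sub_one_mul_sum_pow_mul_le {a : ℕ → ℝ} {Λ q : ℝ} (ha : ∀ k, 0 ≤ a k) (hq : 1 ≤ q)
    (h : ∀ k N, ∑ j ∈ Finset.range N, a (k + j) ≤ Λ * a k) (hΛ : (q - 1) * Λ ≤ 1 / 2) (N : ℕ) :
    (q - 1) * ∑ k ∈ Finset.range N, q ^ k * a k ≤ a 0 := by
  set S := ∑ k ∈ Finset.range N, q ^ k * a k with hS
  have hq0 : 0 ≤ q - 1 := by linarith
  have hgeom : S = ∑ k ∈ Finset.range N, a k +
      (q - 1) * ∑ i ∈ Finset.range N, q ^ i * ∑ k ∈ Finset.Ico (i + 1) N, a k := by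
    have : ∑ i ∈ Finset.range N, q ^ i * ∑ k ∈ Finset.Ico (i + 1) N, a k
        = ∑ k ∈ Finset.range N, (∑ i ∈ Finset.range k, q ^ i) * a k := by
      simp_rw [Finset.mul_sum, Finset.sum_mul, Finset.range_eq_Ico]
      exact Finset.sum_Ico_Ico_comm' 0 N fun i k => q ^ i * a k
    rw [this, Finset.mul_sum, ← Finset.sum_add_distrib]
    refine Finset.sum_congr rfl fun k _ => ?_
    have := geom_sum_mul q k
    linear_combination (-a k) * this
  have htail : ∀ i, ∑ k ∈ Finset.Ico (i + 1) N, a k ≤ Λ * a i := fun i => by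
    refine le_trans ?_ (h i (N - i))
    rw [← Finset.sum_Ico_eq_sum_range]
    exact Finset.sum_le_sum_of_subset_of_nonneg (Finset.Ico_subset_Ico_left (Nat.le_succ i))
      fun _ _ _ => ha _
  have h0 : ∑ k ∈ Finset.range N, a k ≤ Λ * a 0 := by simpa using h 0 N
  have h1 : ∑ i ∈ Finset.range N, q ^ i * ∑ k ∈ Finset.Ico (i + 1) N, a k ≤ Λ * S := by
    rw [hS, Finset.mul_sum]
    refine Finset.sum_le_sum fun i _ => ?_
    have := mul_le_mul_of_nonneg_left (htail i) (pow_nonneg (zero_le_one.trans hq) i)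
    linarith
  have hS0 : 0 ≤ S := Finset.sum_nonneg fun k _ =>
    mul_nonneg (pow_nonneg (zero_le_one.trans hq) k) (ha k)
  have h2 : S ≤ Λ * a 0 + (q - 1) * (Λ * S) := by
    rw [hgeom]
    nth_rw 2 [← hgeom]
    exact add_le_add h0 (mul_le_mul_of_nonneg_left h1 hq0)
  have h3 : S ≤ 2 * (Λ * a 0) := by nlinarith
  nlinarith [ha 0]

namespace SparseTree

variable {ι X : Type*} [MeasurableSpace X] {μ : Measure X} {K : ι → Set X} {ch : ι → Set ι}

theorem lintegral_exp_sub_one_le (T : SparseTree μ K ch) {ν : Measure X} {Λ B lam : ℝ} {f : X → ℝ}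
    {A : ι → ℝ} (p : ι)
    (hoff : ∀ p, ∀ᵐ x ∂μ, x ∈ K p → x ∉ (⋃ r ∈ ch p, K r) → |f x - A p| ≤ B)
    (hstep : ∀ p, ∀ r ∈ ch p, |A r - A p| ≤ B)
    (hνμ : ν ≪ μ) (hνK : ∀ᵐ x ∂ν, x ∈ K p) (hνp : ν (K p) ≠ ⊤)
    (hcar : ∀ k N, ∑ j ∈ Finset.range N, ν (genRegion K ch (k + j) p)
      ≤ ENNReal.ofReal Λ * ν (genRegion K ch k p))
    (hΛ : 0 ≤ Λ) (hB : 0 < B) (hlam : 0 < lam) (hsmall : (Real.exp (B / lam) - 1) * Λ ≤ 1 / 2) :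
    ∫⁻ x, ENNReal.ofReal (Real.exp (|f x - A p| / lam) - 1) ∂ν ≤ ν (K p) := by
  set q := Real.exp (B / lam) with hq
  have hq1 : 1 < q := Real.one_lt_exp_iff.2 (by positivity)
  have hq0 : 0 ≤ q - 1 := by linarith
  have hqk : ∀ k : ℕ, 0 ≤ (q - 1) * q ^ k := fun k => by positivity
  have hfin : ∀ k, ν (genRegion K ch k p) ≠ ⊤ := fun k =>
    ((measure_mono (T.genRegion_subset k p)).trans_lt hνp.lt_top).ne
  have hpt : ∀ᵐ x ∂ν, ENNReal.ofReal (Real.exp (|f x - A p| / lam) - 1) ≤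
      ∑' k : ℕ, (genRegion K ch k p).indicator
        (fun _ => ENNReal.ofReal ((q - 1) * q ^ k)) x := by
    have hall : ∀ᵐ x ∂ν, ∀ k : ℕ, x ∈ K p → x ∉ genRegion K ch k p → |f x - A p| ≤ k * B :=
      ae_all_iff.2 fun k => hνμ.ae_le (T.ae_abs_sub_le_of_notMem_genRegion hoff hstep k p)
    filter_upwards [hall, hνK] with x hx hxK
    obtain ⟨k, hk, hkj⟩ : ∃ k : ℕ, |f x - A p| ≤ k * B ∧ ∀ j < k, x ∈ genRegion K ch j p := by
      classical
      by_cases hex : ∃ k, x ∉ genRegion K ch k p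
      · exact ⟨Nat.find hex, hx _ hxK (Nat.find_spec hex),
          fun j hj => not_not.1 (Nat.find_min hex hj)⟩
      · push Not at hex
        obtain ⟨k, hk⟩ := exists_nat_ge (|f x - A p| / B)
        exact ⟨k, (div_le_iff₀ hB).1 hk, fun j _ => hex j⟩
    calc ENNReal.ofReal (Real.exp (|f x - A p| / lam) - 1)
        ≤ ENNReal.ofReal (q ^ k - 1) := by
          refine ENNReal.ofReal_le_ofReal (sub_le_sub_right ?_ _)
          rw [hq, ← Real.exp_nat_mul, Real.exp_le_exp, ← mul_div_assoc]
          gcongr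
      _ = ∑ j ∈ Finset.range k, ENNReal.ofReal ((q - 1) * q ^ j) := by
          rw [← ENNReal.ofReal_sum_of_nonneg fun j _ => hqk j, ← Finset.mul_sum, mul_comm,
            geom_sum_mul]
      _ = ∑ j ∈ Finset.range k, (genRegion K ch j p).indicator
            (fun _ => ENNReal.ofReal ((q - 1) * q ^ j)) x := by
          refine Finset.sum_congr rfl fun j hj => ?_
          rw [indicator_of_mem (hkj j (Finset.mem_range.1 hj))]
      _ ≤ _ := ENNReal.sum_le_tsum _
  refine (lintegral_mono_ae hpt).trans ?_
  rw [lintegral_tsum fun k =>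
    (measurable_const.indicator (T.measurableSet_genRegion k p)).aemeasurable]
  refine ENNReal.tsum_le_of_sum_range_le fun N => ?_
  have hreal := sub_one_mul_sum_pow_mul_le (a := fun k => (ν (genRegion K ch k p)).toReal)
    (Λ := Λ) (q := q) (fun k => ENNReal.toReal_nonneg) hq1.le (fun k N => by
      have := ENNReal.toReal_mono (ENNReal.mul_ne_top ENNReal.ofReal_ne_top (hfin k)) (hcar k N)
      rwa [ENNReal.toReal_sum fun j _ => hfin _, ENNReal.toReal_mul,
        ENNReal.toReal_ofReal hΛ] at this) hsmall N
  calc ∑ k ∈ Finset.range N, ∫⁻ x, (genRegion K ch k p).indicator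
          (fun _ => ENNReal.ofReal ((q - 1) * q ^ k)) x ∂ν
      = ENNReal.ofReal ((q - 1) * ∑ k ∈ Finset.range N,
          q ^ k * (ν (genRegion K ch k p)).toReal) := by
        rw [Finset.mul_sum, ENNReal.ofReal_sum_of_nonneg fun k _ => by positivity]
        refine Finset.sum_congr rfl fun k _ => ?_
        rw [lintegral_indicator_const (T.measurableSet_genRegion k p), ← mul_assoc,
          ENNReal.ofReal_mul (hqk k), ENNReal.ofReal_toReal (hfin k)]
    _ ≤ ENNReal.ofReal (ν (K p)).toReal := ENNReal.ofReal_le_ofReal hreal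
    _ = ν (K p) := ENNReal.ofReal_toReal hνp

end SparseTree

theorem cube_eq_Icc {n : ℕ} (a : Fin n → ℝ) (h : ℝ) : Cube a h = Icc a (fun i => a i + h) :=
  pi_univ_Icc _ _

theorem cube_eq_closedBall {n : ℕ} (a : Fin n → ℝ) {h : ℝ} (hh : 0 ≤ h) :
    Cube a h = Metric.closedBall (fun i => a i + h / 2) (h / 2) := by
  rw [closedBall_pi _ (by positivity), Cube]
  refine congrArg _ (funext fun i => ?_)
  rw [Real.closedBall_eq_Icc]
  congr 1 <;> ring

theorem volume_cube {n : ℕ} (a : Fin n → ℝ) (h : ℝ) :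
    volume (Cube a h) = ENNReal.ofReal h ^ n := by
  rw [cube_eq_Icc, Real.volume_Icc_pi]
  simp

theorem volume_cube_ne_zero {n : ℕ} (a : Fin n → ℝ) {h : ℝ} (hh : 0 < h) :
    volume (Cube a h) ≠ 0 := by
  rw [volume_cube]
  exact pow_ne_zero _ (ENNReal.ofReal_pos.2 hh).ne'

theorem volume_cube_ne_top {n : ℕ} (a : Fin n → ℝ) (h : ℝ) : volume (Cube a h) ≠ ⊤ := by
  rw [volume_cube]
  exact ENNReal.pow_ne_top ENNReal.ofReal_ne_top

theorem isCompact_cube {n : ℕ} (a : Fin n → ℝ) (h : ℝ) : IsCompact (Cube a h) := by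
  rw [cube_eq_Icc]
  exact isCompact_Icc

/-- A cube parametrized by its lower corner and its positive side length. -/
abbrev CubeIndex (n : ℕ) := {p : (Fin n → ℝ) × ℝ // 0 < p.2}

/-- The half-open cube with a given lower corner and side length. -/
def halfOpenCube {n : ℕ} (p : CubeIndex n) : Set (Fin n → ℝ) :=
  Set.univ.pi fun i => Set.Ico (p.1.1 i) (p.1.1 i + p.1.2)

section HalfOpen

variable {n : ℕ}

theorem halfOpenCube_ae_eq (p : CubeIndex n) :
    halfOpenCube p =ᵐ[volume] Cube p.1.1 p.1.2 := by
  rw [cube_eq_Icc]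
  exact Measure.univ_pi_Ico_ae_eq_Icc

theorem measurableSet_halfOpenCube (p : CubeIndex n) : MeasurableSet (halfOpenCube p) :=
  MeasurableSet.univ_pi fun _ => measurableSet_Ico

theorem halfOpenCube_subset_cube (p : CubeIndex n) : halfOpenCube p ⊆ Cube p.1.1 p.1.2 :=
  pi_mono fun _ _ => Ico_subset_Icc_self

theorem volume_halfOpenCube (p : CubeIndex n) :
    volume (halfOpenCube p) = volume (Cube p.1.1 p.1.2) :=
  measure_congr (halfOpenCube_ae_eq p)

theorem setLIntegral_halfOpenCube (p : CubeIndex n) (g : (Fin n → ℝ) → ℝ≥0∞) :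
    ∫⁻ x in halfOpenCube p, g x = ∫⁻ x in Cube p.1.1 p.1.2, g x :=
  setLIntegral_congr (halfOpenCube_ae_eq p)

theorem ofReal_abs_cubeAvg_sub_le {f : (Fin n → ℝ) → ℝ} (hf : LocallyIntegrable f volume)
    (p : CubeIndex n) {c t : ℝ} (ht : 0 ≤ t)
    (h : ∫⁻ x in halfOpenCube p, ENNReal.ofReal |f x - c| ≤
      ENNReal.ofReal t * volume (halfOpenCube p)) :
    |cubeAvg p.1.1 p.1.2 f - c| ≤ t := by
  rw [setLIntegral_halfOpenCube, volume_halfOpenCube] at h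
  set Q := Cube p.1.1 p.1.2 with hQ
  have hv0 : volume Q ≠ 0 := volume_cube_ne_zero _ p.2
  have hvt : volume Q ≠ ⊤ := volume_cube_ne_top _ _
  have hint : IntegrableOn f Q volume := hf.integrableOn_isCompact (isCompact_cube _ _)
  have hr : 0 < volume.real Q := ENNReal.toReal_pos hv0 hvt
  have heq : ∫ x in Q, (f x - c) = volume.real Q * (cubeAvg p.1.1 p.1.2 f - c) := by
    have hc : IntegrableOn (fun _ => c) Q volume := integrableOn_const hvt
    rw [integral_sub hint hc, setIntegral_const, cubeAvg, setAverage_eq, ← hQ]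
    simp only [smul_eq_mul]
    field_simp
  have hle := enorm_integral_le_lintegral_enorm (μ := volume.restrict Q) fun x => f x - c
  simp_rw [Real.enorm_eq_ofReal_abs] at hle
  have h2 := hle.trans h
  rw [heq, abs_mul, abs_of_pos hr, ← ENNReal.ofReal_toReal hvt, ← ENNReal.ofReal_mul ht,
    ENNReal.ofReal_le_ofReal_iff (by positivity), mul_comm] at h2
  exact le_of_mul_le_mul_right h2 hr

/-- The integer position, in the dyadic grid of level `k` adapted to `p`, of the cell that
contains the point `x`. -/
def dyadicPos (p : CubeIndex n) (k : ℕ) (x : Fin n → ℝ) (i : Fin n) : ℤ :=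
  ⌊(x i - p.1.1 i) / p.1.2 * 2 ^ k⌋

/-- The dyadic cell of level `k`, in the grid adapted to `p`, that contains the point `x`. -/
def dyadicCell (p : CubeIndex n) (k : ℕ) (x : Fin n → ℝ) : CubeIndex n :=
  ⟨(fun i => p.1.1 i + dyadicPos p k x i * (p.1.2 / 2 ^ k), p.1.2 / 2 ^ k),
    div_pos p.2 (by positivity)⟩

theorem mem_dyadicCell_iff (p : CubeIndex n) (k : ℕ) (x y : Fin n → ℝ) :
    y ∈ halfOpenCube (dyadicCell p k x) ↔ dyadicPos p k y = dyadicPos p k x := by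
  have hp := p.2
  have h2 : (0 : ℝ) < 2 ^ k := by positivity
  simp only [halfOpenCube, mem_univ_pi, mem_Ico, funext_iff, dyadicCell]
  refine forall_congr' fun i => ?_
  conv_rhs => rw [dyadicPos, Int.floor_eq_iff]
  have key : (y i - p.1.1 i) / p.1.2 * 2 ^ k = (y i - p.1.1 i) / (p.1.2 / 2 ^ k) := by
    field_simp
  have hs : 0 < p.1.2 / 2 ^ k := by positivity
  rw [key, le_div_iff₀ hs, div_lt_iff₀ hs]
  constructor <;> rintro ⟨h3, h4⟩ <;> constructor <;> linarith

theorem mem_dyadicCell_self (p : CubeIndex n) (k : ℕ) (x : Fin n → ℝ) :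
    x ∈ halfOpenCube (dyadicCell p k x) :=
  (mem_dyadicCell_iff p k x x).2 rfl

theorem dyadicCell_congr {p : CubeIndex n} {k : ℕ} {x y : Fin n → ℝ}
    (h : dyadicPos p k y = dyadicPos p k x) : dyadicCell p k y = dyadicCell p k x := by
  simp only [dyadicCell, h]

theorem dyadicPos_congr_of_le {p : CubeIndex n} {j k : ℕ} (hjk : j ≤ k) {x y : Fin n → ℝ}
    (h : dyadicPos p k y = dyadicPos p k x) : dyadicPos p j y = dyadicPos p j x := by
  have key : ∀ (z : Fin n → ℝ) i, dyadicPos p j z i = dyadicPos p k z i / (2 ^ (k - j) : ℕ) := by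
    intro z i
    rw [dyadicPos, dyadicPos, ← Int.floor_div_natCast]
    congr 1
    rw [← Nat.sub_add_cancel hjk, pow_add]
    push_cast
    rw [Nat.add_sub_cancel]
    field_simp
  funext i
  rw [key, key, h]

theorem dyadicPos_zero {p : CubeIndex n} {x : Fin n → ℝ} (hx : x ∈ halfOpenCube p) :
    dyadicPos p 0 x = 0 := by
  have hp := p.2
  funext i
  have hxi := hx i (mem_univ i)
  rw [mem_Ico] at hxi
  rw [dyadicPos, Pi.zero_apply, Int.floor_eq_zero_iff, pow_zero, mul_one, mem_Ico,
    le_div_iff₀ hp, div_lt_iff₀ hp]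
  constructor <;> linarith

theorem dyadicCell_zero {p : CubeIndex n} {x : Fin n → ℝ} (hx : x ∈ halfOpenCube p) :
    dyadicCell p 0 x = p := by
  refine Subtype.ext (Prod.ext ?_ ?_)
  · funext i
    simp [dyadicCell, dyadicPos_zero hx]
  · simp [dyadicCell]

theorem dyadicCell_subset_of_le (p : CubeIndex n) {j k : ℕ} (hjk : j ≤ k) (x : Fin n → ℝ) :
    halfOpenCube (dyadicCell p k x) ⊆ halfOpenCube (dyadicCell p j x) := fun y hy =>
  (mem_dyadicCell_iff p j x y).2
    (dyadicPos_congr_of_le hjk ((mem_dyadicCell_iff p k x y).1 hy))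

theorem volume_dyadicCell (p : CubeIndex n) (k : ℕ) (x : Fin n → ℝ) :
    volume (halfOpenCube (dyadicCell p k x)) = ENNReal.ofReal (p.1.2 / 2 ^ k) ^ n := by
  rw [volume_halfOpenCube, volume_cube]
  rfl

theorem volume_dyadicCell_pred (p : CubeIndex n) (k : ℕ) (x : Fin n → ℝ) :
    volume (halfOpenCube (dyadicCell p k x)) =
      2 ^ n * volume (halfOpenCube (dyadicCell p (k + 1) x)) := by
  rw [volume_dyadicCell, volume_dyadicCell, ← mul_pow]
  congr 1
  rw [show (2 : ℝ≥0∞) = ENNReal.ofReal 2 by simp, ← ENNReal.ofReal_mul zero_le_two, pow_succ]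
  congr 1
  field_simp

theorem ae_tendsto_cubeAvg_dyadicCell {f : (Fin n → ℝ) → ℝ} (hf : LocallyIntegrable f volume)
    (p : CubeIndex n) : ∀ᵐ x ∂(volume : Measure (Fin n → ℝ)),
      Filter.Tendsto (fun k => cubeAvg (dyadicCell p k x).1.1 (dyadicCell p k x).1.2 f)
        Filter.atTop (nhds (f x)) := by
  filter_upwards [IsUnifLocDoublingMeasure.ae_tendsto_average (μ := volume) hf 1] with x hx
  have hball : ∀ k, Cube (dyadicCell p k x).1.1 (dyadicCell p k x).1.2 =
      Metric.closedBall (fun i => (dyadicCell p k x).1.1 i + (dyadicCell p k x).1.2 / 2)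
        ((dyadicCell p k x).1.2 / 2) := fun k => cube_eq_closedBall _ (dyadicCell p k x).2.le
  have hlim : Filter.Tendsto (fun k => (dyadicCell p k x).1.2 / 2) Filter.atTop
      (nhdsWithin 0 (Ioi 0)) := by
    refine tendsto_nhdsWithin_iff.2 ⟨?_, Filter.Eventually.of_forall fun k =>
      half_pos (dyadicCell p k x).2⟩
    have h1 : Filter.Tendsto (fun k : ℕ => p.1.2 * (1 / 2 : ℝ) ^ k / 2) Filter.atTop (nhds 0) := by
      simpa using ((tendsto_pow_atTop_nhds_zero_of_lt_one (by norm_num : (0 : ℝ) ≤ 1 / 2)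
        (by norm_num)).const_mul p.1.2).div_const 2
    refine h1.congr fun k => ?_
    simp [dyadicCell, div_eq_mul_inv]
  have hmem : ∀ᶠ k in Filter.atTop, x ∈ Metric.closedBall
      (fun i => (dyadicCell p k x).1.1 i + (dyadicCell p k x).1.2 / 2)
        (1 * ((dyadicCell p k x).1.2 / 2)) := Filter.Eventually.of_forall fun k => by
    rw [one_mul, ← hball]
    exact halfOpenCube_subset_cube _ (mem_dyadicCell_self p k x)
  refine (hx _ _ hlim hmem).congr fun k => ?_
  rw [cubeAvg, hball]

end HalfOpen

section Stopping

variable {n : ℕ}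

/-- The maximal dyadic cells of the cube `p` that satisfy `bad`. -/
def maximalCells (bad : CubeIndex n → Prop) (p : CubeIndex n) : Set (CubeIndex n) :=
  {q | ∃ k, ∃ x ∈ halfOpenCube p, q = dyadicCell p k x ∧ bad q ∧
    ∀ j < k, ¬ bad (dyadicCell p j x)}

variable {bad : CubeIndex n → Prop} {p : CubeIndex n}

theorem countable_maximalCells : (maximalCells bad p).Countable := by
  refine (countable_range fun km : ℕ × (Fin n → ℤ) =>
    (⟨(fun i => p.1.1 i + km.2 i * (p.1.2 / 2 ^ km.1), p.1.2 / 2 ^ km.1),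
      div_pos p.2 (by positivity)⟩ : CubeIndex n)).mono ?_
  rintro q ⟨k, x, -, rfl, -⟩
  exact ⟨(k, dyadicPos p k x), rfl⟩

theorem halfOpenCube_subset_of_mem_maximalCells {q : CubeIndex n} (hq : q ∈ maximalCells bad p) :
    halfOpenCube q ⊆ halfOpenCube p := by
  obtain ⟨k, x, hx, rfl, -⟩ := hq
  have := dyadicCell_subset_of_le p k.zero_le x
  rwa [dyadicCell_zero hx] at this

theorem pairwiseDisjoint_maximalCells : (maximalCells bad p).PairwiseDisjoint halfOpenCube := by
  rintro _ ⟨k, x, -, rfl, hkb, hk⟩ _ ⟨l, y, -, rfl, hlb, hl⟩ hne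
  refine disjoint_left.2 fun z hzx hzy => hne ?_
  rw [mem_dyadicCell_iff] at hzx hzy
  have hkl : k = l := by
    rcases lt_trichotomy k l with hlt | heq | hlt
    · refine absurd hkb ?_
      rw [← dyadicCell_congr hzx, dyadicCell_congr (dyadicPos_congr_of_le hlt.le hzy)]
      exact hl k hlt
    · exact heq
    · refine absurd hlb ?_
      rw [← dyadicCell_congr hzy, dyadicCell_congr (dyadicPos_congr_of_le hlt.le hzx)]
      exact hk l hlt
  subst hkl
  rw [← dyadicCell_congr hzx, dyadicCell_congr hzy]

theorem not_bad_dyadicCell_of_notMem {x : Fin n → ℝ} (hx : x ∈ halfOpenCube p)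
    (hxU : x ∉ ⋃ q ∈ maximalCells bad p, halfOpenCube q) (k : ℕ) : ¬ bad (dyadicCell p k x) := by
  induction k using Nat.strong_induction_on with
  | _ k ih =>
    exact fun hb => hxU (mem_iUnion₂.2 ⟨_, ⟨k, x, hx, rfl, hb, ih⟩, mem_dyadicCell_self p k x⟩)

/-- The mean oscillation of `f` about `c` over `q` exceeds `t`. -/
def LargeOscillation (f : (Fin n → ℝ) → ℝ) (c t : ℝ) (q : CubeIndex n) : Prop :=
  ENNReal.ofReal t * volume (halfOpenCube q) < ∫⁻ x in halfOpenCube q, ENNReal.ofReal |f x - c|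

/-- The Calderón–Zygmund stopping cells of `p` for the oscillation of `f` at height `t`. -/
def stoppingCells (f : (Fin n → ℝ) → ℝ) (t : ℝ) (p : CubeIndex n) : Set (CubeIndex n) :=
  maximalCells (LargeOscillation f (cubeAvg p.1.1 p.1.2 f) t) p

variable {f : (Fin n → ℝ) → ℝ} {β : ℝ}

theorem volume_iUnion_stoppingCells_le (hβ : 0 < β)
    (hosc : ∀ p : CubeIndex n, ∫⁻ x in halfOpenCube p,
      ENNReal.ofReal |f x - cubeAvg p.1.1 p.1.2 f| ≤ ENNReal.ofReal β * volume (halfOpenCube p))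
    (p : CubeIndex n) :
    volume (⋃ q ∈ stoppingCells f (2 * β) p, halfOpenCube q) ≤ volume (halfOpenCube p) / 2 := by
  set S := stoppingCells f (2 * β) p
  set U := ⋃ q ∈ S, halfOpenCube q
  have h1 : ENNReal.ofReal (2 * β) * volume U ≤ ENNReal.ofReal β * volume (halfOpenCube p) := by
    calc ENNReal.ofReal (2 * β) * volume U
        = ∑' q : S, ENNReal.ofReal (2 * β) * volume (halfOpenCube (q : CubeIndex n)) := by
          rw [ENNReal.tsum_mul_left]
          exact congrArg _ (measure_biUnion countable_maximalCells pairwiseDisjoint_maximalCells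
            fun q _ => measurableSet_halfOpenCube q)
      _ ≤ ∑' q : S, ∫⁻ x in halfOpenCube (q : CubeIndex n),
            ENNReal.ofReal |f x - cubeAvg p.1.1 p.1.2 f| := by
          refine ENNReal.tsum_le_tsum fun q => ?_
          obtain ⟨k, x, -, -, hb, -⟩ := q.2
          exact hb.le
      _ = ∫⁻ x in U, ENNReal.ofReal |f x - cubeAvg p.1.1 p.1.2 f| :=
          (lintegral_biUnion countable_maximalCells (fun q _ => measurableSet_halfOpenCube q)
            pairwiseDisjoint_maximalCells _).symm
      _ ≤ ∫⁻ x in halfOpenCube p, ENNReal.ofReal |f x - cubeAvg p.1.1 p.1.2 f| :=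
          lintegral_mono_set (iUnion₂_subset fun q hq =>
            halfOpenCube_subset_of_mem_maximalCells hq)
      _ ≤ _ := hosc p
  rw [mul_comm 2 β, ENNReal.ofReal_mul hβ.le, mul_assoc,
    ENNReal.mul_le_mul_iff_right (ENNReal.ofReal_pos.2 hβ).ne' ENNReal.ofReal_ne_top] at h1
  rw [ENNReal.le_div_iff_mul_le (Or.inl two_ne_zero) (Or.inl ofNat_ne_top), mul_comm]
  simpa using h1

theorem abs_cubeAvg_sub_le_of_mem_stoppingCells (hf : LocallyIntegrable f volume) (hβ : 0 < β)
    (hosc : ∀ p : CubeIndex n, ∫⁻ x in halfOpenCube p,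
      ENNReal.ofReal |f x - cubeAvg p.1.1 p.1.2 f| ≤ ENNReal.ofReal β * volume (halfOpenCube p))
    {p q : CubeIndex n} (hq : q ∈ stoppingCells f (2 * β) p) :
    |cubeAvg q.1.1 q.1.2 f - cubeAvg p.1.1 p.1.2 f| ≤ 2 ^ (n + 1) * β := by
  obtain ⟨k, x, hx, rfl, hb, hk⟩ := hq
  refine ofReal_abs_cubeAvg_sub_le hf _ (by positivity) ?_
  cases k with
  | zero =>
    rw [dyadicCell_zero hx] at hb
    refine absurd (hosc p) (not_le.2 (lt_of_le_of_lt ?_ hb))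
    gcongr
    linarith
  | succ k =>
    calc _ ≤ ∫⁻ x in halfOpenCube (dyadicCell p k x),
          ENNReal.ofReal |f x - cubeAvg p.1.1 p.1.2 f| :=
          lintegral_mono_set (dyadicCell_subset_of_le p k.le_succ x)
      _ ≤ ENNReal.ofReal (2 * β) * volume (halfOpenCube (dyadicCell p k x)) :=
          not_lt.1 (hk k k.lt_succ_self)
      _ = _ := by
          rw [volume_dyadicCell_pred, ← mul_assoc, show (2 : ℝ≥0∞) ^ n = ENNReal.ofReal (2 ^ n) by
            rw [ENNReal.ofReal_pow zero_le_two]; simp, ← ENNReal.ofReal_mul (by positivity)]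
          congr 2
          ring

theorem ae_abs_sub_cubeAvg_le_of_notMem_stoppingCells (hf : LocallyIntegrable f volume)
    (hβ : 0 < β) (p : CubeIndex n) :
    ∀ᵐ x ∂(volume : Measure (Fin n → ℝ)), x ∈ halfOpenCube p →
      x ∉ (⋃ q ∈ stoppingCells f (2 * β) p, halfOpenCube q) →
        |f x - cubeAvg p.1.1 p.1.2 f| ≤ 2 ^ (n + 1) * β := by
  filter_upwards [ae_tendsto_cubeAvg_dyadicCell hf p] with x hx hxp hxU
  refine (le_of_tendsto (hx.sub_const _).abs (Filter.Eventually.of_forall fun k =>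
    ofReal_abs_cubeAvg_sub_le hf _ (by positivity)
      (not_lt.1 (not_bad_dyadicCell_of_notMem hxp hxU k)))).trans ?_
  rw [pow_succ, mul_assoc]
  exact le_mul_of_one_le_left (by positivity) (one_le_pow₀ one_le_two)

theorem sparseTree_stoppingCells (hβ : 0 < β)
    (hosc : ∀ p : CubeIndex n, ∫⁻ x in halfOpenCube p,
      ENNReal.ofReal |f x - cubeAvg p.1.1 p.1.2 f| ≤ ENNReal.ofReal β * volume (halfOpenCube p)) :
    SparseTree (volume : Measure (Fin n → ℝ)) halfOpenCube (stoppingCells f (2 * β)) where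
  meas := measurableSet_halfOpenCube
  countable _ := countable_maximalCells
  subset _ _ hr := halfOpenCube_subset_of_mem_maximalCells hr
  disj _ := pairwiseDisjoint_maximalCells
  half := volume_iUnion_stoppingCells_le hβ hosc
  ne_zero p := by
    rw [volume_halfOpenCube]
    exact volume_cube_ne_zero _ p.2
  ne_top p := by
    rw [volume_halfOpenCube]
    exact volume_cube_ne_top _ _

end Stopping

section Weight

variable {n : ℕ} {w f : (Fin n → ℝ) → ℝ}

/-- The measure `w dx`. -/
def weightMeasure (w : (Fin n → ℝ) → ℝ) : Measure (Fin n → ℝ) :=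
  volume.withDensity fun x => ENNReal.ofReal (w x)

theorem weightMeasure_halfOpenCube (p : CubeIndex n) :
    weightMeasure w (halfOpenCube p) = wInt w p.1.1 p.1.2 := by
  rw [weightMeasure, withDensity_apply _ (measurableSet_halfOpenCube p), wInt,
    setLIntegral_halfOpenCube]

theorem wInt_ne_top (hw : IsWeight w) (a : Fin n → ℝ) (h : ℝ) : wInt w a h ≠ ⊤ := by
  have hint : IntegrableOn w (Cube a h) volume := hw.2.integrableOn_isCompact (isCompact_cube a h)
  have h2 := hint.2
  rw [hasFiniteIntegral_iff_ofReal (Filter.Eventually.of_forall hw.1)] at h2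
  exact h2.ne

theorem lintegral_maxFn_le (hw : IsWeight w) (hfw : fwConst w < ⊤) {a : Fin n → ℝ} {h : ℝ}
    (hh : 0 < h) :
    ∫⁻ x in Cube a h, maxFn ((Cube a h).indicator w) x ≤ fwConst w * wInt w a h := by
  rw [← ENNReal.div_le_iff_le_mul (Or.inr hfw.ne) (Or.inl (wInt_ne_top hw a h)), fwConst]
  exact le_iSup_of_le a (le_iSup_of_le h (le_iSup_of_le hh le_rfl))

theorem weightMeasure_div_le_maxFn (hw : IsWeight w) {p r : CubeIndex n}
    (hrp : halfOpenCube r ⊆ halfOpenCube p) {x : Fin n → ℝ} (hx : x ∈ halfOpenCube r) :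
    weightMeasure w (halfOpenCube r) / volume (halfOpenCube r) ≤
      maxFn ((Cube p.1.1 p.1.2).indicator w) x := by
  have heq : weightMeasure w (halfOpenCube r) = ∫⁻ y in Cube r.1.1 r.1.2,
      ENNReal.ofReal |(Cube p.1.1 p.1.2).indicator w y| := by
    rw [weightMeasure, withDensity_apply _ (measurableSet_halfOpenCube r),
      ← setLIntegral_halfOpenCube]
    refine setLIntegral_congr_fun (measurableSet_halfOpenCube r) fun y hy => ?_
    rw [indicator_of_mem (halfOpenCube_subset_cube p (hrp hy)), abs_of_nonneg (hw.1 y)]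
  rw [heq, volume_halfOpenCube, maxFn]
  exact le_iSup_of_le r.1.1 (le_iSup_of_le r.1.2 (le_iSup_of_le r.2
    (le_iSup_of_le (halfOpenCube_subset_cube r hx) le_rfl)))

theorem SparseTree.sum_weightMeasure_genRegion_le {ch : CubeIndex n → Set (CubeIndex n)}
    (T : SparseTree volume halfOpenCube ch) (hw : IsWeight w) (hfw : fwConst w < ⊤)
    (N : ℕ) (p : CubeIndex n) :
    ∑ j ∈ Finset.range N, weightMeasure w (genRegion halfOpenCube ch j p) ≤
      2 * fwConst w * weightMeasure w (halfOpenCube p) := by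
  refine (T.sum_measure_genRegion_le (weightMeasure w) N p fun r hrp x hx =>
    weightMeasure_div_le_maxFn hw hrp hx).trans ?_
  rw [setLIntegral_halfOpenCube, weightMeasure_halfOpenCube, mul_assoc]
  gcongr
  exact lintegral_maxFn_le hw hfw p.2

theorem one_le_two_mul_fwConst {ch : CubeIndex n → Set (CubeIndex n)}
    (T : SparseTree volume halfOpenCube ch) (hw : IsWeight w) (hfw : fwConst w < ⊤)
    {p : CubeIndex n} (hp : wInt w p.1.1 p.1.2 ≠ 0) : 1 ≤ 2 * fwConst w := by
  have h := T.sum_weightMeasure_genRegion_le hw hfw 1 p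
  rw [Finset.sum_range_one, genRegion, weightMeasure_halfOpenCube] at h
  rw [← ENNReal.mul_le_mul_iff_left hp (wInt_ne_top hw _ _), one_mul]
  exact h

theorem expLuxNorm_le_of_oscillation_le (hw : IsWeight w) (hfw : fwConst w < ⊤)
    (hf : LocallyIntegrable f volume) {β : ℝ} (hβ : 0 < β)
    (hosc : ∀ p : CubeIndex n, ∫⁻ x in halfOpenCube p,
      ENNReal.ofReal |f x - cubeAvg p.1.1 p.1.2 f| ≤ ENNReal.ofReal β * volume (halfOpenCube p))
    (p : CubeIndex n) (hp : wInt w p.1.1 p.1.2 ≠ 0) :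
    expLuxNorm ((wInt w p.1.1 p.1.2)⁻¹ • wMeasureOn w (Cube p.1.1 p.1.2)) 1
        (fun x => f x - cubeAvg p.1.1 p.1.2 f) ≤
      ENNReal.ofReal (2 ^ (n + 4)) * fwConst w * ENNReal.ofReal β := by
  have T := sparseTree_stoppingCells hβ hosc
  set F := (fwConst w).toReal
  have hF : fwConst w = ENNReal.ofReal F := (ENNReal.ofReal_toReal hfw.ne).symm
  have h2F : 2 * fwConst w = ENNReal.ofReal (2 * F) := by
    rw [ENNReal.ofReal_mul zero_le_two, hF]; simp
  have hF1 : 1 ≤ 2 * F := by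
    have := one_le_two_mul_fwConst T hw hfw hp
    rwa [h2F, ENNReal.one_le_ofReal] at this
  have hF0 : 0 < F := by linarith
  set lam := 2 ^ (n + 4) * F * β with hlam
  have hlam0 : 0 < lam := by positivity
  have hν : wMeasureOn w (Cube p.1.1 p.1.2) = (weightMeasure w).restrict (halfOpenCube p) := by
    rw [wMeasureOn, ← Measure.restrict_congr_set (halfOpenCube_ae_eq p), weightMeasure,
      restrict_withDensity (measurableSet_halfOpenCube p)]
  have hres : ∀ k, (weightMeasure w).restrict (halfOpenCube p)
      (genRegion halfOpenCube (stoppingCells f (2 * β)) k p) =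
        weightMeasure w (genRegion halfOpenCube (stoppingCells f (2 * β)) k p) := fun k =>
    Measure.restrict_eq_self _ (T.genRegion_subset k p)
  have hmain := T.lintegral_exp_sub_one_le (f := f) (A := fun p => cubeAvg p.1.1 p.1.2 f)
    (ν := (weightMeasure w).restrict (halfOpenCube p)) (Λ := 2 * F) (lam := lam) p
    (ae_abs_sub_cubeAvg_le_of_notMem_stoppingCells hf hβ)
    (fun p r hr => abs_cubeAvg_sub_le_of_mem_stoppingCells hf hβ hosc hr)
    (Measure.absolutelyContinuous_of_le Measure.restrict_le_self |>.trans
      (withDensity_absolutelyContinuous _ _))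
    (ae_restrict_mem (measurableSet_halfOpenCube p))
    (by
      rw [Measure.restrict_apply_self, weightMeasure_halfOpenCube]
      exact wInt_ne_top hw _ _)
    (fun k N => by
      simp_rw [hres]
      rw [← h2F]
      exact T.sum_measure_genRegion_add_le _ N (T.sum_weightMeasure_genRegion_le hw hfw N) k p)
    (by positivity) (by positivity) hlam0 (by
      have hx : 2 ^ (n + 1) * β / lam = 1 / (8 * F) := by
        rw [hlam]
        field_simp
        ring
      rw [hx]
      have hx1 : |1 / (8 * F)| ≤ 1 := by
        rw [abs_of_pos (by positivity), div_le_one (by positivity)]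
        linarith
      have h3 := (le_abs_self _).trans (Real.abs_exp_sub_one_le hx1)
      rw [abs_of_pos (by positivity)] at h3
      calc (Real.exp (1 / (8 * F)) - 1) * (2 * F) ≤ 2 * (1 / (8 * F)) * (2 * F) := by gcongr
        _ = 1 / 2 := by field_simp; norm_num)
  rw [Measure.restrict_apply_self, weightMeasure_halfOpenCube] at hmain
  have hgoal : ENNReal.ofReal (2 ^ (n + 4)) * fwConst w * ENNReal.ofReal β =
      ENNReal.ofReal lam := by
    rw [hF, hlam, ENNReal.ofReal_mul (by positivity), ENNReal.ofReal_mul (by positivity)]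
  rw [hgoal, expLuxNorm]
  refine iInf_le_of_le lam (iInf_le_of_le hlam0 (iInf_le_of_le ?_ le_rfl))
  rw [lintegral_smul_measure, hν, smul_eq_mul]
  simp_rw [Real.rpow_one]
  calc _ ≤ (wInt w p.1.1 p.1.2)⁻¹ * wInt w p.1.1 p.1.2 := by gcongr
    _ = 1 := ENNReal.inv_mul_cancel hp (wInt_ne_top hw _ _)

theorem expLuxNorm_zero {X : Type*} [MeasurableSpace X] (b : ℝ) (g : X → ℝ) :
    expLuxNorm (0 : Measure X) b g = 0 := by
  refine le_antisymm (ENNReal.le_of_forall_pos_le_add fun ε hε _ => ?_) zero_le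
  rw [zero_add, expLuxNorm]
  refine iInf_le_of_le (ε : ℝ) (iInf_le_of_le (by exact_mod_cast hε)
    (iInf_le_of_le (by simp) ?_))
  simp

theorem setLIntegral_abs_sub_cubeAvg_le {β : ℝ} (hβ : bmoNorm f ≤ ENNReal.ofReal β)
    (p : CubeIndex n) : ∫⁻ x in halfOpenCube p, ENNReal.ofReal |f x - cubeAvg p.1.1 p.1.2 f| ≤
      ENNReal.ofReal β * volume (halfOpenCube p) := by
  rw [setLIntegral_halfOpenCube, volume_halfOpenCube, ← ENNReal.div_le_iff_le_mul
    (Or.inl (volume_cube_ne_zero _ p.2)) (Or.inl (volume_cube_ne_top _ _))]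
  refine le_trans ?_ hβ
  rw [bmoNorm]
  exact le_iSup_of_le p.1.1 (le_iSup_of_le p.1.2 (le_iSup_of_le p.2 le_rfl))

end Weight

/-- for `w ∈ A∞` and `f ∈ BMO`, for every cube `Q`,
`‖f - f_Q‖_{exp L(Q, w dx/w(Q))} ≤ C_n [w]_{A∞} ‖f‖_BMO`. -/
theorem stmt8 (n : ℕ) :
    ∃ C : ℝ, 0 < C ∧
      ∀ (w f : (Fin n → ℝ) → ℝ), IsWeight w → fwConst w < ⊤ →
        LocallyIntegrable f volume → bmoNorm f < ⊤ →
        ∀ (a : Fin n → ℝ) (h : ℝ), 0 < h →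
          expLuxNorm ((wInt w a h)⁻¹ • wMeasureOn w (Cube a h)) 1
              (fun x => f x - cubeAvg a h f)
            ≤ ENNReal.ofReal C * fwConst w * bmoNorm f := by
  refine ⟨2 ^ (n + 4), by positivity, fun w f hw hfw hf hbmo a h hh => ?_⟩
  by_cases hp : wInt w a h = 0
  · have hz : wMeasureOn w (Cube a h) = 0 := by
      rw [← Measure.measure_univ_eq_zero, wMeasureOn, withDensity_apply _ MeasurableSet.univ,
        Measure.restrict_univ]
      exact hp
    rw [hz, smul_zero, expLuxNorm_zero]
    exact zero_le
  have hbound : ∀ ε : ℝ, 0 < ε →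
      expLuxNorm ((wInt w a h)⁻¹ • wMeasureOn w (Cube a h)) 1 (fun x => f x - cubeAvg a h f) ≤
        ENNReal.ofReal (2 ^ (n + 4)) * fwConst w * ENNReal.ofReal ((bmoNorm f).toReal + ε) :=
    fun ε hε => expLuxNorm_le_of_oscillation_le hw hfw hf (by positivity)
      (setLIntegral_abs_sub_cubeAvg_le (by
        rw [← ENNReal.ofReal_toReal hbmo.ne]
        exact ENNReal.ofReal_le_ofReal (by rw [ENNReal.ofReal_toReal hbmo.ne]; linarith)))
      ⟨(a, h), hh⟩ hp
  have hlim : Filter.Tendsto (fun ε : ℝ => ENNReal.ofReal (2 ^ (n + 4)) * fwConst w *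
      ENNReal.ofReal ((bmoNorm f).toReal + ε)) (nhdsWithin 0 (Ioi 0))
      (nhds (ENNReal.ofReal (2 ^ (n + 4)) * fwConst w * bmoNorm f)) := by
    refine ENNReal.Tendsto.const_mul ?_
      (Or.inr (ENNReal.mul_ne_top ENNReal.ofReal_ne_top hfw.ne))
    have hc : Continuous fun ε : ℝ => ENNReal.ofReal ((bmoNorm f).toReal + ε) :=
      ENNReal.continuous_ofReal.comp (continuous_const.add continuous_id)
    have := (hc.tendsto 0).mono_left (nhdsWithin_le_nhds (s := Ioi 0))
    rwa [add_zero, ENNReal.ofReal_toReal hbmo.ne] at this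
  exact ge_of_tendsto hlim (eventually_mem_nhdsWithin.mono hbound)
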